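/- Let n ≥ 2 be an even integer, F a free group of finite rank, ε : F → D_n a surjective group homomorphism, and R = ker ε. Then the relation module R^{ab} is coflabby but not flabby: (1) H^1(S, R^{ab}) = 0 for every subgroup S of D_n; (2) for the subgroup S = ⟨σ^{n/2}, τ⟩ (isomorphic to C_2 × C_2), the Tate cohomology group Ĥ^{−1}(S, R^{ab}) — i.e., the quotient of {x ∈ R^{ab} : Σ_{s ∈ S} s·x = 0} by the subgroup generated by {s·x − x : s ∈ S, x ∈ R^{ab}} — is isomorphic to ℤ/2ℤ; in particular it is nonzero. -/

import Mathlib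

/-- The "norm" homomorphism `x ↦ Σ_{s ∈ S} s • x` for the Klein four subgroup
`S = ⟨σ^{n/2}, τ⟩ = {1, σ^{n/2}, τ, σ^{n/2}τ}` of `D_n` (`n` even), acting on a
`ℤ[D_n]`-module `M`. -/
noncomputable def kleinNorm (n : ℕ) (M : Type) [AddCommGroup M]
    [Module (MonoidAlgebra ℤ (DihedralGroup n)) M] : M →+ M :=
  AddMonoidHom.id M
    + DistribMulAction.toAddMonoidHom M
        (MonoidAlgebra.of ℤ (DihedralGroup n) (DihedralGroup.r ((n / 2 : ℕ) : ZMod n)))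
    + DistribMulAction.toAddMonoidHom M
        (MonoidAlgebra.of ℤ (DihedralGroup n) (DihedralGroup.sr 0))
    + DistribMulAction.toAddMonoidHom M
        (MonoidAlgebra.of ℤ (DihedralGroup n) (DihedralGroup.sr ((n / 2 : ℕ) : ZMod n)))

/-- The subgroup of `M` generated by `{s • x - x : s ∈ S, x ∈ M}` for the subgroup
`S = ⟨σ^{n/2}, τ⟩` of `D_n`. -/
noncomputable def kleinCobdry (n : ℕ) (M : Type) [AddCommGroup M]
    [Module (MonoidAlgebra ℤ (DihedralGroup n)) M] : AddSubgroup M :=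
  AddSubgroup.closure {y | ∃ (s : DihedralGroup n) (x : M),
    s ∈ Subgroup.closure
      {DihedralGroup.r ((n / 2 : ℕ) : ZMod n), DihedralGroup.sr 0} ∧
    y = MonoidAlgebra.of ℤ (DihedralGroup n) s • x - x}

/-- Left translation of functions on a group: `(g · f) h = f (g⁻¹ h)`. -/
def leftTranslate {G V : Type*} [Group G] [AddCommGroup V] (g : G) : (G → V) →+ (G → V) where
  toFun f h := f (g⁻¹ * h)
  map_zero' := rfl
  map_add' _ _ := rfl

@[simp]
theorem leftTranslate_apply {G V : Type*} [Group G] [AddCommGroup V] (g : G) (f : G → V) (h : G) :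
    leftTranslate g f h = f (g⁻¹ * h) := rfl

theorem leftTranslate_mul {G V : Type*} [Group G] [AddCommGroup V] (g g' : G) (f : G → V) :
    leftTranslate (g * g') f = leftTranslate g (leftTranslate g' f) := by
  ext h; simp [mul_assoc]

theorem leftTranslate_one {G V : Type*} [Group G] [AddCommGroup V] (f : G → V) :
    leftTranslate (1 : G) f = f := by
  ext h; simp

theorem leftTranslate_single {G V : Type*} [Group G] [DecidableEq G] [AddCommGroup V]
    (g h : G) (v : V) :
    leftTranslate g (Pi.single h v) = Pi.single (g * h) v := by
  ext k
  by_cases hk : k = g * h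
  · subst hk; simp
  · have : g⁻¹ * k ≠ h := fun H => hk (by rw [← H]; group)
    simp [hk, this]

/-- The indicator function of a transversal of a subgroup. -/
theorem Subgroup.exists_transversal_indicator {G : Type*} [Group G] (S : Subgroup G) [Fintype S] :
    ∃ e : G → ℤ, ∀ g, ∑ s : S, e ((s : G)⁻¹ * g) = 1 := by
  classical
  obtain ⟨T, hT, -⟩ := S.exists_isComplement_right 1
  refine ⟨fun g => if g ∈ T then 1 else 0, fun g => ?_⟩
  obtain ⟨⟨s, t⟩, hst, huniq⟩ := hT.existsUnique g
  have hst' : (s : G) * t = g := hst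
  rw [Finset.sum_eq_single (⟨s, s.2⟩ : S)]
  · simp [← hst']
  · intro s' _ hs'
    refine if_neg fun hmem => hs' ?_
    have := huniq (⟨s', s'.2⟩, ⟨_, hmem⟩) (by simp)
    exact Subtype.ext (congrArg (fun p => (p.1 : G)) this)
  · simp

/-- `H¹(S, V^G) = 0`. -/
theorem exists_leftTranslate_sub_of_cocycle {G V : Type*} [Group G] [CommRing V]
    (S : Subgroup G) [Fintype S] (c : S → G → V)
    (hc : ∀ s t : S, c (s * t) = c s + leftTranslate (s : G) (c t)) :
    ∃ u : G → V, ∀ s : S, c s = leftTranslate (s : G) u - u := by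
  obtain ⟨e, he⟩ := S.exists_transversal_indicator
  refine ⟨fun h => -∑ t : S, (e ((t : G)⁻¹ * h) : V) * c t h, fun s => ?_⟩
  ext h
  have h1 : ∑ t : S, (e ((t : G)⁻¹ * ((s : G)⁻¹ * h)) : V) * c t ((s : G)⁻¹ * h)
      = ∑ t : S, (e ((t : G)⁻¹ * h) : V) * (c t h - c s h) := by
    rw [← Equiv.sum_comp (Equiv.mulLeft s) fun t : S => (e ((t : G)⁻¹ * h) : V) * (c t h - c s h)]
    refine Finset.sum_congr rfl fun t _ => ?_
    simp [hc s t, mul_assoc]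
  have h2 : ∑ t : S, (e ((t : G)⁻¹ * h) : V) = 1 := by
    exact_mod_cast congrArg (Int.cast (R := V)) (he h)
  simp only [Pi.sub_apply, leftTranslate_apply, h1, mul_sub, Finset.sum_sub_distrib,
    ← Finset.sum_mul, h2]
  ring

/-- `Ĥ⁰(S, V^G) = 0`. -/
theorem exists_eq_sum_leftTranslate_of_invariant {G V : Type*} [Group G] [CommRing V]
    (S : Subgroup G) [Fintype S] (w : G → V) (hw : ∀ s : S, leftTranslate (s : G) w = w) :
    ∃ v : G → V, w = ∑ s : S, leftTranslate (s : G) v := by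
  obtain ⟨e, he⟩ := S.exists_transversal_indicator
  refine ⟨fun h => e h * w h, ?_⟩
  ext h
  have h1 (s : S) : w ((s : G)⁻¹ * h) = w h := congrFun (hw s) h
  have h2 : ∑ t : S, (e ((t : G)⁻¹ * h) : V) = 1 := by
    exact_mod_cast congrArg (Int.cast (R := V)) (he h)
  simp [h1, ← Finset.sum_mul, h2]

/-- An exact sequence `0 → M → V^G → ℤ^G → ℤ` of `G`-modules, for a finite group `G`. -/
structure RelationSequence (G V M : Type*) [Group G] [Fintype G] [AddCommGroup V]
    [AddCommGroup M] [Module (MonoidAlgebra ℤ G) M] where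
  /-- the inclusion of `M` -/
  incl : M →+ (G → V)
  /-- the boundary map -/
  bdry : (G → V) →+ (G → ℤ)
  incl_injective : Function.Injective incl
  incl_smul : ∀ (g : G) (m : M), incl (MonoidAlgebra.of ℤ G g • m) = leftTranslate g (incl m)
  bdry_leftTranslate : ∀ (g : G) (u : G → V), bdry (leftTranslate g u) = leftTranslate g (bdry u)
  bdry_incl : ∀ m, bdry (incl m) = 0
  exists_incl : ∀ u, bdry u = 0 → ∃ m, incl m = u
  sum_bdry : ∀ u, ∑ g, bdry u g = 0
  exists_bdry : ∀ w : G → ℤ, ∑ g, w g = 0 → ∃ v, bdry v = w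

namespace RelationSequence

theorem coflabby {G V M : Type*} [Group G] [Fintype G] [CommRing V]
    [AddCommGroup M] [Module (MonoidAlgebra ℤ G) M] (Q : RelationSequence G V M)
    (S : Subgroup G) (c : S → M)
    (hc : ∀ s t : S, c (s * t) = c s + MonoidAlgebra.of ℤ G (s : G) • c t) :
    ∃ m : M, ∀ s : S, c s = MonoidAlgebra.of ℤ G (s : G) • m - m := by
  classical
  obtain ⟨u, hu⟩ := exists_leftTranslate_sub_of_cocycle S (fun s => Q.incl (c s))
    (fun s t => by rw [hc, map_add, Q.incl_smul])
  obtain ⟨w, hw⟩ := exists_eq_sum_leftTranslate_of_invariant S (Q.bdry u) (fun s => by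
    rw [← Q.bdry_leftTranslate, ← sub_eq_zero, ← map_sub, ← hu, Q.bdry_incl])
  have hw0 : ∑ g, w g = 0 := by
    have h1 : ∑ g, Q.bdry u g = Fintype.card S • ∑ g, w g := by
      rw [hw]
      simp only [Finset.sum_apply, leftTranslate_apply]
      rw [Finset.sum_comm]
      have (s : S) : ∑ g, w ((s : G)⁻¹ * g) = ∑ g, w g :=
        Equiv.sum_comp (Equiv.mulLeft (s : G)⁻¹) w
      simp [this]
    rw [Q.sum_bdry] at h1
    simpa using h1.symm
  obtain ⟨v, rfl⟩ := Q.exists_bdry w hw0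
  obtain ⟨m, hm⟩ := Q.exists_incl (u - ∑ s : S, leftTranslate (s : G) v) (by
    simp only [map_sub, map_sum, Q.bdry_leftTranslate]
    rw [← hw, sub_self])
  refine ⟨m, fun s => Q.incl_injective ?_⟩
  have h2 : leftTranslate (s : G) (∑ t : S, leftTranslate (t : G) v)
      = ∑ t : S, leftTranslate (t : G) v := by
    simp only [map_sum, ← leftTranslate_mul]
    exact Equiv.sum_comp (Equiv.mulLeft s) (fun t : S => leftTranslate (t : G) v)
  rw [map_sub, Q.incl_smul, hm, map_sub, h2, hu]
  abel

end RelationSequence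

/-- `e` is the indicator function of a transversal of the Klein four subgroup `{1, a, b, ab}`. -/
structure IsKleinTransversal {G : Type*} [Group G] (a b : G) (e : G → ℤ) : Prop where
  inv_left : a⁻¹ = a
  inv_right : b⁻¹ = b
  comm : b * a = a * b
  sum_eq_one : ∀ g, e g + e (a * g) + e (b * g) + e (a * (b * g)) = 1

namespace IsKleinTransversal

theorem exists_of_involutions {G : Type*} [Group G] {a b : G} (ha : a⁻¹ = a) (hb : b⁻¹ = b)
    (hab : b * a = a * b) (ha1 : a ≠ 1) (hb1 : b ≠ 1) (hne : a ≠ b) :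
    ∃ e : G → ℤ, IsKleinTransversal a b e := by
  classical
  have haa : a * a = 1 := by nth_rewrite 1 [← ha]; simp
  have hbb : b * b = 1 := by nth_rewrite 1 [← hb]; simp
  have hba' (g : G) : b * (a * g) = a * (b * g) := by rw [← mul_assoc, hab, mul_assoc]
  have haa' (g : G) : a * (a * g) = g := by rw [← mul_assoc, haa, one_mul]
  have hbb' (g : G) : b * (b * g) = g := by rw [← mul_assoc, hbb, one_mul]
  let K : Finset G := {1, a, b, a * b}
  let S : Subgroup G :=
    { carrier := K
      one_mem' := by simp [K]
      mul_mem' := by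
        intro x y hx hy
        simp only [K, Finset.coe_insert, Finset.coe_singleton, Set.mem_insert_iff,
          Set.mem_singleton_iff] at hx hy ⊢
        rcases hx with rfl | rfl | rfl | rfl <;> rcases hy with rfl | rfl | rfl | rfl <;>
          simp [haa, hbb, hab, haa', hba', mul_assoc]
      inv_mem' := by
        intro x hx
        simp only [K, Finset.coe_insert, Finset.coe_singleton, Set.mem_insert_iff,
          Set.mem_singleton_iff] at hx ⊢
        rcases hx with rfl | rfl | rfl | rfl <;> simp [ha, hb, hab] }
  have hS (x : G) : x ∈ K ↔ x ∈ S := Iff.rfl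
  have : Fintype S := Fintype.ofFinset K hS
  obtain ⟨e, he⟩ := S.exists_transversal_indicator
  refine ⟨e, ha, hb, hab, fun g => ?_⟩
  have h := he g
  have hab1 : a * b ≠ 1 := fun H => hne (by rw [eq_inv_of_mul_eq_one_left H, hb])
  rw [← Finset.sum_subtype K hS (fun s => e (s⁻¹ * g))] at h
  rw [← h, Finset.sum_insert (by simp [ha1.symm, hb1.symm, hab1.symm]),
    Finset.sum_insert (by simp [hne, hb1]), Finset.sum_insert (by simp [ha1]),
    Finset.sum_singleton]
  simp [ha, hb, hba', mul_assoc, add_assoc]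

variable {G : Type*} [Group G] {a b : G} {e : G → ℤ}

theorem left_left (K : IsKleinTransversal a b e) (g : G) : a * (a * g) = g := by
  nth_rewrite 1 [← K.inv_left]; simp

theorem right_right (K : IsKleinTransversal a b e) (g : G) : b * (b * g) = g := by
  nth_rewrite 1 [← K.inv_right]; simp

theorem right_left (K : IsKleinTransversal a b e) (g : G) : b * (a * g) = a * (b * g) := by
  rw [← mul_assoc, K.comm, mul_assoc]

theorem sum_cast_eq_one (K : IsKleinTransversal a b e) (R : Type*) [CommRing R] (g : G) :
    (e g + e (a * g) + e (b * g) + e (a * (b * g)) : R) = 1 := by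
  exact_mod_cast congrArg (Int.cast (R := R)) (K.sum_eq_one g)

/-- The elements killed by the norm of `⟨a⟩`. -/
theorem exists_sub_of_add_eq_zero (K : IsKleinTransversal a b e) {u : G → ℤ}
    (hu : leftTranslate a u + u = 0) : ∃ v, u = leftTranslate a v - v := by
  refine ⟨fun g => -((e g + e (b * g)) * u g), ?_⟩
  ext g
  have h := congrFun hu g
  simp only [Pi.add_apply, Pi.sub_apply, leftTranslate_apply, K.inv_left, K.right_left,
    Pi.zero_apply] at h ⊢
  linear_combination (-u g) * K.sum_eq_one g + (e (a * g) + e (a * (b * g))) * h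

theorem exists_add_of_eq (K : IsKleinTransversal a b e) {u : G → ℤ}
    (hu : leftTranslate a u = u) : ∃ v, u = leftTranslate a v + v := by
  refine ⟨fun g => (e g + e (b * g)) * u g, ?_⟩
  ext g
  have h := congrFun hu g
  simp only [Pi.add_apply, leftTranslate_apply, K.inv_left, K.right_left] at h ⊢
  linear_combination (-u g) * K.sum_eq_one g - (e (a * g) + e (a * (b * g))) * h

theorem exists_norm_of_eq (K : IsKleinTransversal a b e) {u : G → ℤ}
    (hu : leftTranslate a u = u) (hu' : leftTranslate b u = u) :
    ∃ v, u = leftTranslate a (leftTranslate b v + v) + (leftTranslate b v + v) := by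
  refine ⟨fun g => e g * u g, ?_⟩
  ext g
  have ha := congrFun hu g
  have hb := congrFun hu' g
  have hab := congrFun hu (b * g)
  simp only [Pi.add_apply, leftTranslate_apply, K.inv_left, K.inv_right, K.right_left]
    at ha hb hab ⊢
  linear_combination (-u g) * K.sum_eq_one g - e (a * g) * ha - e (b * g) * hb
    - e (a * (b * g)) * (hab + hb)

theorem leftTranslate_left (K : IsKleinTransversal a b e) {V : Type*} [AddCommGroup V]
    (u : G → V) : leftTranslate a (leftTranslate a u) = u := by
  ext g; simp [K.inv_left, K.left_left]

theorem leftTranslate_right (K : IsKleinTransversal a b e) {V : Type*} [AddCommGroup V]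
    (u : G → V) : leftTranslate b (leftTranslate b u) = u := by
  ext g; simp [K.inv_right, K.right_right]

theorem leftTranslate_comm (K : IsKleinTransversal a b e) {V : Type*} [AddCommGroup V]
    (u : G → V) :
    leftTranslate b (leftTranslate a u) = leftTranslate a (leftTranslate b u) := by
  ext g; simp [K.inv_left, K.inv_right, K.right_left]

/-- The Koszul-type resolution of the Klein four group is exact in degree one. -/
theorem exists_koszul (K : IsKleinTransversal a b e) {p q : G → ℤ}
    (h : (leftTranslate a p - p) + (leftTranslate b q - q) = 0) :
    ∃ α β γ : G → ℤ, p = leftTranslate a α + α + (leftTranslate b γ - γ) ∧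
      q = leftTranslate b β + β - (leftTranslate a γ - γ) := by
  have hN : leftTranslate b (leftTranslate a q + q) = leftTranslate a q + q := by
    have h' := congrArg (leftTranslate a) h
    simp only [map_add, map_sub, map_zero, K.leftTranslate_left] at h'
    rw [map_add, K.leftTranslate_comm, ← sub_eq_zero]
    rw [← add_zero (0 : G → ℤ)]
    nth_rewrite 1 [← h]
    rw [← h']
    abel
  obtain ⟨β, hβ⟩ := K.exists_norm_of_eq (u := leftTranslate a q + q)
    (by rw [map_add, K.leftTranslate_left, add_comm]) hN
  obtain ⟨γ, hγ⟩ := K.exists_sub_of_add_eq_zero (u := leftTranslate b β + β - q) (by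
    rw [map_sub, ← sub_eq_zero.2 hβ.symm]; abel)
  obtain ⟨α, hα⟩ := K.exists_add_of_eq (u := p - (leftTranslate b γ - γ)) (by
    have hq : q = leftTranslate b β + β - (leftTranslate a γ - γ) := by rw [← hγ]; abel
    rw [hq] at h
    simp only [map_add, map_sub, K.leftTranslate_right, K.leftTranslate_comm] at h ⊢
    rw [← sub_eq_zero, ← h]
    abel)
  exact ⟨α, β, γ, by rw [← hα]; abel, by rw [← hγ]; abel⟩

end IsKleinTransversal

/-- The sum of the coefficients over a transversal of `⟨b⟩`, modulo two, where `e` is the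
indicator function of a transversal of `{1, a, b, ab}`. -/
def parity {G : Type*} [Group G] [Fintype G] (a : G) (e : G → ℤ) : (G → ℤ) →+ ZMod 2 where
  toFun p := ((∑ g, e g * (p g + p (a * g)) : ℤ) : ZMod 2)
  map_zero' := by simp
  map_add' p q := by
    rw [← Int.cast_add, ← Finset.sum_add_distrib]
    congr 1
    exact Finset.sum_congr rfl fun g _ => by simp only [Pi.add_apply]; ring

/-- The first component `y` in a decomposition `u = (a - 1) y + (b - 1) z` of an element `u` of
norm zero. -/
def kleinLift {G : Type*} [Group G] (V : Type*) [CommRing V] (a b : G) (e : G → ℤ) :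
    (G → V) →+ (G → V) where
  toFun u g := (e g + e (b * g)) * u (a * g)
  map_zero' := by ext; simp
  map_add' u v := by ext; simp [mul_add]

namespace IsKleinTransversal

variable {G : Type*} [Group G] {a b : G} {e : G → ℤ}

theorem parity_add [Fintype G] (K : IsKleinTransversal a b e) (w : G → ℤ) :
    parity a e (leftTranslate a w + w) = 0 := by
  have : ∑ g, e g * ((leftTranslate a w + w) g + (leftTranslate a w + w) (a * g))
      = 2 * ∑ g, e g * (w g + w (a * g)) := by
    rw [Finset.mul_sum]
    refine Finset.sum_congr rfl fun g _ => ?_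
    simp only [Pi.add_apply, leftTranslate_apply, K.inv_left, K.left_left]
    ring
  change ((∑ g, _ : ℤ) : ZMod 2) = 0
  rw [this]
  push_cast
  rw [show (2 : ZMod 2) = 0 from rfl, zero_mul]

theorem parity_sub [Fintype G] (K : IsKleinTransversal a b e) (w : G → ℤ) :
    parity a e (leftTranslate b w - w) = ((∑ g, w g : ℤ) : ZMod 2) := by
  have ha : ∑ g, e g * w (a * g) = ∑ g, e (a * g) * w g := by
    rw [← Equiv.sum_comp (Equiv.mulLeft a)]; simp [K.left_left]
  have hb : ∑ g, e g * w (b * g) = ∑ g, e (b * g) * w g := by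
    rw [← Equiv.sum_comp (Equiv.mulLeft b)]; simp [K.right_right]
  have hab : ∑ g, e g * w (a * (b * g)) = ∑ g, e (a * (b * g)) * w g := by
    rw [← Equiv.sum_comp (Equiv.mulLeft (a * b))]
    simp [K.left_left, K.right_right, K.right_left]
  have : ∑ g, e g * ((leftTranslate b w - w) g + (leftTranslate b w - w) (a * g))
      = ∑ g, w g - 2 * ∑ g, e g * (w g + w (a * g)) := by
    have h1 : ∑ g, w g = ∑ g, e g * (w g + w (a * g) + w (b * g) + w (a * (b * g))) := by
      simp only [mul_add, Finset.sum_add_distrib, ha, hb, hab]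
      simp only [← Finset.sum_add_distrib, ← add_mul, K.sum_eq_one, one_mul]
    rw [h1, Finset.mul_sum, ← Finset.sum_sub_distrib]
    refine Finset.sum_congr rfl fun g _ => ?_
    simp only [Pi.sub_apply, leftTranslate_apply, K.inv_right, K.right_left]
    ring
  change ((∑ g, _ : ℤ) : ZMod 2) = _
  rw [this]
  push_cast
  rw [show (2 : ZMod 2) = 0 from rfl, zero_mul, sub_zero]

variable {V : Type*} [CommRing V]

theorem kleinLift_left (K : IsKleinTransversal a b e) (u : G → V) :
    kleinLift V a b e (leftTranslate a u - u)
      = u - (leftTranslate a (kleinLift V a b e u) + kleinLift V a b e u) := by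
  ext g
  simp only [kleinLift, AddMonoidHom.coe_mk, ZeroHom.coe_mk, Pi.sub_apply, Pi.add_apply,
    leftTranslate_apply, K.inv_left, K.left_left, K.right_left]
  linear_combination (u g) * K.sum_cast_eq_one V g

theorem kleinLift_right (K : IsKleinTransversal a b e) (u : G → V) :
    kleinLift V a b e (leftTranslate b u - u)
      = leftTranslate b (kleinLift V a b e u) - kleinLift V a b e u := by
  ext g
  simp only [kleinLift, AddMonoidHom.coe_mk, ZeroHom.coe_mk, Pi.sub_apply,
    leftTranslate_apply, K.inv_right, K.right_right, K.right_left]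
  ring

theorem eq_kleinLift_add (K : IsKleinTransversal a b e) {u : G → V}
    (hu : u + leftTranslate a u + leftTranslate b u + leftTranslate a (leftTranslate b u) = 0) :
    ∃ z, u = (leftTranslate a (kleinLift V a b e u) - kleinLift V a b e u)
      + (leftTranslate b z - z) := by
  refine ⟨fun g => e g * (u (b * g) + u (a * (b * g))), ?_⟩
  ext g
  have h := congrFun hu g
  simp only [kleinLift, AddMonoidHom.coe_mk, ZeroHom.coe_mk, Pi.sub_apply, Pi.add_apply,
    Pi.zero_apply, leftTranslate_apply, K.inv_left, K.inv_right, K.left_left, K.right_right,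
    K.right_left] at h ⊢
  linear_combination (-u g) * K.sum_cast_eq_one V g + e g * h

end IsKleinTransversal

namespace RelationSequence

variable {G V M : Type*} [Group G] [Fintype G] [CommRing V]
    [AddCommGroup M] [Module (MonoidAlgebra ℤ G) M]

/-- The class in `ℤ/2` that computes `Ĥ⁻¹` for the Klein four group `{1, a, b, ab}`. -/
def kleinClass (Q : RelationSequence G V M) (a b : G) (e : G → ℤ) : M →+ ZMod 2 :=
  (parity a e).comp (Q.bdry.comp ((kleinLift V a b e).comp Q.incl))

variable (Q : RelationSequence G V M) {a b : G} {e : G → ℤ}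

theorem kleinClass_left (K : IsKleinTransversal a b e) (m : M) :
    Q.kleinClass a b e (MonoidAlgebra.of ℤ G a • m - m) = 0 := by
  simp only [kleinClass, AddMonoidHom.comp_apply]
  rw [map_sub, Q.incl_smul, K.kleinLift_left, map_sub, Q.bdry_incl, map_add,
    Q.bdry_leftTranslate, map_sub, K.parity_add, map_zero, sub_zero]

theorem kleinClass_right (K : IsKleinTransversal a b e) (m : M) :
    Q.kleinClass a b e (MonoidAlgebra.of ℤ G b • m - m) = 0 := by
  simp only [kleinClass, AddMonoidHom.comp_apply]
  rw [map_sub, Q.incl_smul, K.kleinLift_right, map_sub,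
    Q.bdry_leftTranslate, K.parity_sub, Q.sum_bdry, Int.cast_zero]

theorem exists_of_kleinClass_eq_zero (K : IsKleinTransversal a b e) {x : M}
    (hN : x + MonoidAlgebra.of ℤ G a • x + MonoidAlgebra.of ℤ G b • x
      + MonoidAlgebra.of ℤ G (a * b) • x = 0)
    (hx : Q.kleinClass a b e x = 0) :
    ∃ y z : M, x = (MonoidAlgebra.of ℤ G a • y - y) + (MonoidAlgebra.of ℤ G b • z - z) := by
  rw [map_mul, mul_smul] at hN
  obtain ⟨z, hz⟩ := K.eq_kleinLift_add (u := Q.incl x) (by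
    simp only [← Q.incl_smul, ← map_add, hN, map_zero])
  simp only [kleinClass, AddMonoidHom.comp_apply] at hx
  set y := kleinLift V a b e (Q.incl x)
  have hrel := congrArg Q.bdry hz
  simp only [Q.bdry_incl, map_add, map_sub, Q.bdry_leftTranslate] at hrel
  obtain ⟨α, β, γ, hp, hq⟩ := K.exists_koszul hrel.symm
  have hsum (g : G) (w : G → ℤ) : ∑ h, w (g⁻¹ * h) = ∑ h, w h :=
    Equiv.sum_comp (Equiv.mulLeft g⁻¹) w
  have hα : ∑ g, α g = 0 := by
    have := Q.sum_bdry y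
    rw [hp] at this
    simp only [Pi.add_apply, Pi.sub_apply, leftTranslate_apply, Finset.sum_add_distrib,
      Finset.sum_sub_distrib, hsum] at this
    lia
  have hβ : ∑ g, β g = 0 := by
    have := Q.sum_bdry z
    rw [hq] at this
    simp only [Pi.add_apply, Pi.sub_apply, leftTranslate_apply, Finset.sum_add_distrib,
      Finset.sum_sub_distrib, hsum] at this
    lia
  have hγ : (2 : ℤ) ∣ ∑ g, γ g := by
    rw [hp, map_add, K.parity_add, zero_add, K.parity_sub] at hx
    exact (ZMod.intCast_zmod_eq_zero_iff_dvd _ 2).1 hx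
  obtain ⟨k, hk⟩ := hγ
  classical
  set δ : G → ℤ := Pi.single 1 k with hδ
  have hδs : ∑ g, δ g = k := by simp [hδ]
  obtain ⟨α', hα'⟩ := Q.exists_bdry (α + (leftTranslate b δ - δ)) (by
    simp only [Pi.add_apply, Pi.sub_apply, leftTranslate_apply, Finset.sum_add_distrib,
      Finset.sum_sub_distrib, hsum]
    lia)
  obtain ⟨β', hβ'⟩ := Q.exists_bdry β hβ
  obtain ⟨γ', hγ'⟩ := Q.exists_bdry (γ - (leftTranslate a δ + δ)) (by
    simp only [Pi.add_apply, Pi.sub_apply, leftTranslate_apply, Finset.sum_add_distrib,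
      Finset.sum_sub_distrib, hsum]
    lia)
  obtain ⟨m, hm⟩ := Q.exists_incl
      (y - (leftTranslate a α' + α') - (leftTranslate b γ' - γ')) (by
    simp only [map_sub, map_add, Q.bdry_leftTranslate, hα', hγ', hp, K.leftTranslate_comm]
    abel)
  obtain ⟨l, hl⟩ := Q.exists_incl
      (z - (leftTranslate b β' + β') + (leftTranslate a γ' - γ')) (by
    simp only [map_sub, map_add, Q.bdry_leftTranslate, hβ', hγ', hq, K.leftTranslate_left]
    abel)
  refine ⟨m, l, Q.incl_injective ?_⟩
  rw [map_add, map_sub, map_sub, Q.incl_smul, Q.incl_smul, hm, hl, hz]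
  simp only [map_sub, map_add, K.leftTranslate_left, K.leftTranslate_right, K.leftTranslate_comm]
  abel

theorem exists_kleinClass_eq_one (K : IsKleinTransversal a b e) :
    ∃ x : M, x + MonoidAlgebra.of ℤ G a • x + MonoidAlgebra.of ℤ G b • x
      + MonoidAlgebra.of ℤ G (a * b) • x = 0 ∧ Q.kleinClass a b e x = 1 := by
  classical
  set δ : G → ℤ := Pi.single 1 1 with hδ
  have hδs : ∑ g, δ g = 1 := by simp [hδ]
  have hsum (g : G) (w : G → ℤ) : ∑ h, w (g⁻¹ * h) = ∑ h, w h :=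
    Equiv.sum_comp (Equiv.mulLeft g⁻¹) w
  have hsub (g : G) : ∑ h, (leftTranslate g δ - δ) h = 0 := by
    simp only [Pi.sub_apply, leftTranslate_apply, Finset.sum_sub_distrib, hsum, sub_self]
  obtain ⟨y, hy⟩ := Q.exists_bdry _ (hsub b)
  obtain ⟨z, hz⟩ := Q.exists_bdry _ (hsub a)
  obtain ⟨x, hx⟩ := Q.exists_incl
      ((leftTranslate a y - y) - (leftTranslate b z - z)) (by
    simp only [map_sub, Q.bdry_leftTranslate, hy, hz, K.leftTranslate_comm]
    abel)
  refine ⟨x, Q.incl_injective ?_, ?_⟩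
  · simp only [map_add, Q.incl_smul, hx, leftTranslate_mul, map_sub, map_zero,
      K.leftTranslate_left, K.leftTranslate_right, K.leftTranslate_comm]
    abel
  · simp only [kleinClass, AddMonoidHom.comp_apply]
    rw [hx, map_sub, K.kleinLift_left, K.kleinLift_right]
    simp only [map_sub, map_add (Q.bdry), Q.bdry_leftTranslate]
    rw [hy, K.parity_sub, K.parity_add, ← map_sub, K.parity_sub, Q.sum_bdry, hδs]
    simp

end RelationSequence

/-- The universal crossed homomorphism of Fox calculus. -/
theorem exists_foxDerivative {G X : Type*} [Group G] [DecidableEq G] [DecidableEq X]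
    (ε : FreeGroup X →* G) :
    ∃ D : FreeGroup X → G → X → ℤ,
      (∀ x, D (FreeGroup.of x) = Pi.single 1 (Pi.single x 1)) ∧
      ∀ f g, D (f * g) = D f + leftTranslate (ε f) (D g) := by
  let A (x : X) : Equiv.Perm (G → X → ℤ) :=
    { toFun := fun u => Pi.single 1 (Pi.single x 1) + leftTranslate (ε (FreeGroup.of x)) u
      invFun := fun u => leftTranslate (ε (FreeGroup.of x))⁻¹ (u - Pi.single 1 (Pi.single x 1))
      left_inv := fun u => by
        beta_reduce
        rw [add_sub_cancel_left, ← leftTranslate_mul, inv_mul_cancel, leftTranslate_one]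
      right_inv := fun u => by
        beta_reduce
        rw [← leftTranslate_mul, mul_inv_cancel, leftTranslate_one, add_sub_cancel] }
  let Φ := FreeGroup.lift A
  have hΦ (f : FreeGroup X) : ∀ u, Φ f u = Φ f 0 + leftTranslate (ε f) u := by
    have hA (x : X) (u : G → X → ℤ) : Φ (FreeGroup.of x) u
        = Pi.single 1 (Pi.single x 1) + leftTranslate (ε (FreeGroup.of x)) u := by
      simp [Φ, A]
    induction f using FreeGroup.induction_on with
    | C1 => intro u; simp [leftTranslate_one]
    | of x => intro u; rw [hA, hA, map_zero, add_zero]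
    | inv_of x ih =>
      have hinv (u : G → X → ℤ) : Φ (FreeGroup.of x)⁻¹ u
          = leftTranslate (ε (FreeGroup.of x))⁻¹ (u - Pi.single 1 (Pi.single x 1)) := by
        simp [Φ, A]
      intro u
      rw [hinv, hinv, zero_sub, map_inv, map_sub, map_neg]
      abel
    | mul f g hf hg =>
      intro u
      rw [map_mul, Equiv.Perm.mul_apply, Equiv.Perm.mul_apply, hg, hf, hf (Φ g 0), map_add,
        map_mul, leftTranslate_mul, add_assoc]
  refine ⟨fun f => Φ f 0, fun x => by simp [Φ, A], fun f g => ?_⟩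
  change Φ (f * g) 0 = Φ f 0 + leftTranslate (ε f) (Φ g 0)
  rw [map_mul, Equiv.Perm.mul_apply, hΦ]

/-- The relation sequence `0 → R^{ab} → ℤ[G]^X → ℤ[G] → ℤ` of a free presentation of a finite
group `G`. -/
theorem nonempty_relationSequence {G X M : Type*} [Group G] [Fintype G] [Fintype X]
    (ε : FreeGroup X →* G) (hε : Function.Surjective ε)
    [AddCommGroup M] [Module (MonoidAlgebra ℤ G) M] (π : ε.ker → M)
    (hπadd : ∀ r s : ε.ker, π (r * s) = π r + π s)
    (hπsurj : Function.Surjective π)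
    (hπker : ∀ r : ε.ker, π r = 0 ↔
      (r : FreeGroup X) ∈ (⁅ε.ker, ε.ker⁆ : Subgroup (FreeGroup X)))
    (hπconj : ∀ (f : FreeGroup X) (r s : ε.ker), (s : FreeGroup X) = f * r * f⁻¹ →
      π s = MonoidAlgebra.of ℤ G (ε f) • π r) :
    Nonempty (RelationSequence G (X → ℤ) M) := by
  classical
  obtain ⟨D, hDof, hDmul⟩ := exists_foxDerivative ε
  choose t ht using hε
  have hD1 : D 1 = 0 := by
    have := hDmul 1 1
    rw [mul_one, map_one, leftTranslate_one] at this
    exact left_eq_add.1 this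
  have hDinv (f : FreeGroup X) : leftTranslate (ε f) (D f⁻¹) = - D f := by
    have := hDmul f f⁻¹
    rw [mul_inv_cancel, hD1] at this
    exact eq_neg_of_add_eq_zero_right this.symm
  have hDdiv {f g : FreeGroup X} (h : ε f = ε g) : D (f * g⁻¹) = D f - D g := by
    rw [hDmul, h, hDinv, sub_eq_add_neg]
  have hDR (r s : FreeGroup X) (hr : ε r = 1) : D (r * s) = D r + D s := by
    rw [hDmul, hr, leftTranslate_one]
  have hDcomm : ∀ r ∈ (⁅ε.ker, ε.ker⁆ : Subgroup (FreeGroup X)), D r = 0 := by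
    let K : Subgroup (FreeGroup X) :=
      { carrier := {f | ε f = 1 ∧ D f = 0}
        one_mem' := ⟨map_one ε, hD1⟩
        mul_mem' := fun {f g} hf hg => ⟨by rw [map_mul, hf.1, hg.1, one_mul], by
          rw [hDR f g hf.1, hf.2, hg.2, add_zero]⟩
        inv_mem' := fun {f} hf => ⟨by rw [map_inv, hf.1, inv_one], by
          have := hDinv f
          rwa [hf.1, leftTranslate_one, hf.2, neg_zero] at this⟩ }
    have hK : (⁅ε.ker, ε.ker⁆ : Subgroup (FreeGroup X)) ≤ K := by
      rw [Subgroup.commutator_le]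
      intro r hr s hs
      rw [MonoidHom.mem_ker] at hr hs
      refine ⟨by simp [commutatorElement_def, hr, hs], ?_⟩
      rw [commutatorElement_def, hDdiv (by simp [hr]), hDdiv (by simp [hr, hs]), hDR r s hr]
      abel
    exact fun r hr => (hK hr).2
  have hDπ (r s : ε.ker) (h : π r = π s) : D r = D s := by
    have h1 : π (r * s⁻¹) = 0 := by
      have := hπadd (r * s⁻¹) s
      rw [inv_mul_cancel_right, h] at this
      exact right_eq_add.1 this
    have h2 := hDcomm _ ((hπker _).1 h1)
    rw [Subgroup.coe_mul, Subgroup.coe_inv,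
      hDdiv ((MonoidHom.mem_ker.1 r.2).trans (MonoidHom.mem_ker.1 s.2).symm)] at h2
    exact sub_eq_zero.1 h2
  choose ρ hρ using hπsurj
  let incl : M →+ (G → X → ℤ) := AddMonoidHom.mk' (fun m => D (ρ m)) fun m l => by
    rw [← hDR _ _ (ρ m).2, ← Subgroup.coe_mul]
    exact hDπ _ _ (by rw [hπadd, hρ, hρ, hρ])
  have hincl (r : ε.ker) : incl (π r) = D r := hDπ _ _ (hρ _)
  let bdry : (G → X → ℤ) →+ (G → ℤ) :=
    { toFun := fun u h => ∑ x, (u (h * (ε (FreeGroup.of x))⁻¹) x - u h x)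
      map_zero' := by ext; simp
      map_add' := fun u v => by
        ext h
        simp only [Pi.add_apply, ← Finset.sum_add_distrib]
        exact Finset.sum_congr rfl fun x _ => by ring }
  have hbdry (u : G → X → ℤ) (h : G) :
      bdry u h = ∑ x, (u (h * (ε (FreeGroup.of x))⁻¹) x - u h x) := rfl
  have hbdryT (g : G) (u : G → X → ℤ) :
      bdry (leftTranslate g u) = leftTranslate g (bdry u) := by
    ext h
    simp only [hbdry, leftTranslate_apply, mul_assoc]
  have hbdryD (f : FreeGroup X) : bdry (D f) = Pi.single (ε f) 1 - Pi.single 1 1 := by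
    induction f using FreeGroup.induction_on with
    | C1 => simp [hD1]
    | of x =>
      ext h
      rw [hbdry, hDof, Finset.sum_eq_single x]
      · simp only [Pi.sub_apply, Pi.single_apply, mul_inv_eq_one]
        split_ifs <;> simp
      · intro y _ hy
        simp only [Pi.single_apply]
        split_ifs <;> simp [hy]
      · simp
    | inv_of x ih =>
      have h1 := congrArg (fun u => leftTranslate (ε (FreeGroup.of x))⁻¹ (bdry u))
        (hDinv (FreeGroup.of x))
      simp only [hbdryT, ← leftTranslate_mul, inv_mul_cancel, leftTranslate_one, map_neg, ih,
        map_sub, leftTranslate_single, mul_one] at h1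
      rw [h1, map_inv]
      abel
    | mul f g hf hg =>
      rw [hDmul, map_add, hbdryT, hf, hg, map_sub, leftTranslate_single, leftTranslate_single,
        map_mul, mul_one]
      abel
  let μ (g : G) (f : FreeGroup X) : M :=
    π ⟨t g * f * (t (g * ε f))⁻¹, by simp [MonoidHom.mem_ker, ht]⟩
  have hμ (g : G) (f : FreeGroup X) :
      incl (μ g f) = D (t g) + leftTranslate g (D f) - D (t (g * ε f)) := by
    rw [hincl, hDdiv (by simp [ht]), hDmul, ht]
  have hμmul (g : G) (f f' : FreeGroup X) : μ g (f * f') = μ g f + μ (g * ε f) f' := by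
    rw [← hπadd]
    refine congrArg π (Subtype.ext ?_)
    simp only [Subgroup.coe_mul, map_mul, mul_assoc, inv_mul_cancel_left]
  have hμ1 (g : G) : μ g 1 = 0 := by
    have := hμmul g 1 1
    rw [mul_one, map_one, mul_one] at this
    exact left_eq_add.1 this
  have hμπ (r : ε.ker) : μ 1 r = π r := by
    have hr : ε r = 1 := r.2
    change π _ = π r
    rw [hπconj (t 1) r ⟨t 1 * r * (t (1 * ε r))⁻¹, by simp [MonoidHom.mem_ker, ht]⟩
      (by simp [hr]), ht, map_one, one_smul]
  let φ : (G → X → ℤ) →+ M :=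
    { toFun := fun u => ∑ g, ∑ x, u g x • μ g (FreeGroup.of x)
      map_zero' := by simp
      map_add' := fun u v => by simp [add_smul, Finset.sum_add_distrib] }
  have hφ (u : G → X → ℤ) : φ u = ∑ g, ∑ x, u g x • μ g (FreeGroup.of x) := rfl
  have hφD (f : FreeGroup X) : ∀ g, φ (leftTranslate g (D f)) = μ g f := by
    induction f using FreeGroup.induction_on with
    | C1 => intro g; rw [hD1, map_zero, map_zero, hμ1]
    | of x =>
      intro g
      rw [hDof, leftTranslate_single, mul_one, hφ, Finset.sum_eq_single g, Finset.sum_eq_single x]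
      · simp
      · intro y _ hy; simp [hy]
      · simp
      · intro h _ hh; simp [hh]
      · simp
    | inv_of x ih =>
      intro g
      have h1 := hDmul (FreeGroup.of x)⁻¹ (FreeGroup.of x)
      have h2 := hμmul g (FreeGroup.of x)⁻¹ (FreeGroup.of x)
      rw [inv_mul_cancel, hD1] at h1
      rw [inv_mul_cancel, hμ1] at h2
      rw [eq_neg_of_add_eq_zero_left h1.symm, eq_neg_of_add_eq_zero_left h2.symm, map_neg,
        map_neg, ← leftTranslate_mul, ih]
    | mul f f' hf hf' =>
      intro g
      rw [hDmul, map_add, map_add, hf, ← leftTranslate_mul, hf', hμmul]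
  refine ⟨⟨incl, bdry, ?_, ?_, hbdryT, ?_, ?_, ?_, ?_⟩⟩
  · refine Function.LeftInverse.injective (g := φ) fun m => ?_
    rw [← hρ m, hincl, ← hμπ, ← hφD, leftTranslate_one]
  · intro g m
    let s : ε.ker := ⟨t g * ρ m * (t g)⁻¹, (MonoidHom.normal_ker ε).conj_mem _ (ρ m).2 _⟩
    have hm : ε (ρ m) = 1 := (ρ m).2
    have hs := hπconj (t g) (ρ m) s rfl
    rw [hρ, ht] at hs
    rw [← hs, hincl, hDdiv (by simp [hm]), hDmul, ht, add_sub_cancel_left]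
    rfl
  · intro m
    have hm : ε (ρ m) = 1 := (ρ m).2
    rw [← hρ m, hincl, hbdryD, hm, sub_self]
  · intro u hu
    refine ⟨φ u, ?_⟩
    have h1 : ∑ g, ∑ x, u g x • leftTranslate g (D (FreeGroup.of x)) = u := by
      ext h y
      simp only [hDof, leftTranslate_single, mul_one, Finset.sum_apply, Pi.smul_apply]
      rw [Finset.sum_eq_single h, Finset.sum_eq_single y]
      · simp
      · intro z _ hz; simp [hz.symm]
      · simp
      · intro k _ hk; simp [hk.symm]
      · simp
    have h2 : ∑ g, ∑ x, u g x • (D (t (g * ε (FreeGroup.of x))) - D (t g))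
        = ∑ g, bdry u g • D (t g) := by
      simp only [hbdry, Finset.sum_smul, sub_smul, smul_sub, Finset.sum_sub_distrib]
      congr 1
      rw [Finset.sum_comm, Finset.sum_comm (γ := G)]
      refine Finset.sum_congr rfl fun x _ => ?_
      rw [← Equiv.sum_comp (Equiv.mulRight (ε (FreeGroup.of x))) fun g =>
        u (g * (ε (FreeGroup.of x))⁻¹) x • D (t g)]
      simp
    calc incl (φ u)
        = ∑ g, ∑ x, u g x • leftTranslate g (D (FreeGroup.of x))
          - ∑ g, ∑ x, u g x • (D (t (g * ε (FreeGroup.of x))) - D (t g)) := by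
          rw [hφ, map_sum, ← Finset.sum_sub_distrib]
          refine Finset.sum_congr rfl fun g _ => ?_
          rw [map_sum, ← Finset.sum_sub_distrib]
          refine Finset.sum_congr rfl fun x _ => ?_
          rw [map_zsmul, hμ, ← smul_sub]
          congr 1
          abel
      _ = u := by rw [h1, h2, hu]; simp
  · intro u
    simp only [hbdry]
    rw [Finset.sum_comm]
    refine Finset.sum_eq_zero fun x _ => ?_
    rw [Finset.sum_sub_distrib, sub_eq_zero]
    exact Equiv.sum_comp (Equiv.mulRight (ε (FreeGroup.of x))⁻¹) fun h => u h x
  · intro w hw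
    refine ⟨∑ g, w g • D (t g), ?_⟩
    simp only [map_sum, map_zsmul, hbdryD, ht, smul_sub, Finset.sum_sub_distrib,
      ← Finset.sum_smul, hw, zero_smul, sub_zero]
    ext h
    simp [Finset.sum_apply, Pi.single_apply]

/-- for even `n ≥ 2` and any free presentation `1 → R → F → D_n → 1`,
the relation module `R^{ab}` is coflabby but not flabby:
(1) `H^1(S, R^{ab}) = 0` for every subgroup `S ≤ D_n` (every 1-cocycle is a
coboundary), and
(2) for the Klein four subgroup `S = ⟨σ^{n/2}, τ⟩`, the Tate cohomology group
`Ĥ^{-1}(S, R^{ab})` — the quotient of `{x : Σ_{s ∈ S} s • x = 0}` by the subgroup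
generated by `{s • x - x : s ∈ S}` — is isomorphic to `ℤ/2ℤ`.

The relation module `R^{ab}` is characterised as a `ℤ[D_n]`-module `M` together
with a surjective map `π : R → M` satisfying `π(rs) = π(r) + π(s)`, with kernel
exactly `[R, R]`, and compatible with conjugation: `π(f r f⁻¹) = ε(f) • π(r)`. -/
theorem relationModule_coflabby_not_flabby (n : ℕ) (hn : 2 ≤ n) (heven : Even n)
    [NeZero n]
    (d : ℕ) (ε : FreeGroup (Fin d) →* DihedralGroup n) (hε : Function.Surjective ε)
    (M : Type) [AddCommGroup M] [Module (MonoidAlgebra ℤ (DihedralGroup n)) M]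
    (π : ε.ker → M)
    (hπadd : ∀ r s : ε.ker, π (r * s) = π r + π s)
    (hπsurj : Function.Surjective π)
    (hπker : ∀ r : ε.ker, π r = 0 ↔
      (r : FreeGroup (Fin d)) ∈ (⁅ε.ker, ε.ker⁆ : Subgroup (FreeGroup (Fin d))))
    (hπconj : ∀ (f : FreeGroup (Fin d)) (r s : ε.ker),
      (s : FreeGroup (Fin d)) = f * r * f⁻¹ →
      π s = MonoidAlgebra.of ℤ (DihedralGroup n) (ε f) • π r) :
    (∀ (S : Subgroup (DihedralGroup n)) (c : ↥S → M),
      (∀ s t : ↥S, c (s * t) = c s + MonoidAlgebra.of ℤ (DihedralGroup n) (↑s) • c t) →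
      ∃ m : M, ∀ s : ↥S, c s = MonoidAlgebra.of ℤ (DihedralGroup n) (↑s) • m - m) ∧
    Nonempty ((↥((kleinNorm n M).ker) ⧸
      (kleinCobdry n M).addSubgroupOf (kleinNorm n M).ker) ≃+ ZMod 2) := by
  classical
  obtain ⟨Q⟩ := nonempty_relationSequence ε hε π hπadd hπsurj hπker hπconj
  refine ⟨Q.coflabby, ?_⟩
  have h2 : ((n / 2 : ℕ) : ZMod n) + ((n / 2 : ℕ) : ZMod n) = 0 := by
    rw [← Nat.cast_add, ← two_mul, Nat.two_mul_div_two_of_even heven, ZMod.natCast_self]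
  have h0 : ((n / 2 : ℕ) : ZMod n) ≠ 0 := by
    rw [Ne, ZMod.natCast_eq_zero_iff]
    exact fun h => absurd (Nat.le_of_dvd (by omega) h) (by omega)
  set k : ZMod n := ((n / 2 : ℕ) : ZMod n) with hk
  have hneg : -k = k := neg_eq_of_add_eq_zero_left h2
  have hab : DihedralGroup.r k * DihedralGroup.sr 0 = DihedralGroup.sr k := by
    rw [DihedralGroup.r_mul_sr, zero_sub, hneg]
  obtain ⟨e, K⟩ := IsKleinTransversal.exists_of_involutions (a := DihedralGroup.r k)
    (b := DihedralGroup.sr 0) (by simp [hneg]) (by simp) (by simp [hneg])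
    (fun h => h0 (DihedralGroup.r.inj h)) (fun h => nomatch h) (fun h => nomatch h)
  have hnorm (x : M) : kleinNorm n M x = x + MonoidAlgebra.of ℤ (DihedralGroup n) (DihedralGroup.r k) • x
      + MonoidAlgebra.of ℤ (DihedralGroup n) (DihedralGroup.sr 0) • x
      + MonoidAlgebra.of ℤ (DihedralGroup n) (DihedralGroup.r k * DihedralGroup.sr 0) • x := by
    rw [hab]
    rfl
  let Θ := (Q.kleinClass (DihedralGroup.r k) (DihedralGroup.sr 0) e).comp
    (kleinNorm n M).ker.subtype
  have hsurj : Function.Surjective Θ := by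
    obtain ⟨x, hx, hx1⟩ := Q.exists_kleinClass_eq_one K
    have hx' : x ∈ (kleinNorm n M).ker := by rw [AddMonoidHom.mem_ker, hnorm, hx]
    intro c
    refine ⟨c.val • ⟨x, hx'⟩, ?_⟩
    rw [map_nsmul]
    change c.val • Q.kleinClass _ _ e x = c
    rw [hx1, nsmul_one, ZMod.natCast_zmod_val]
  have hker : (kleinCobdry n M).addSubgroupOf (kleinNorm n M).ker = Θ.ker := by
    ext ⟨x, hx⟩
    rw [AddSubgroup.mem_addSubgroupOf, AddMonoidHom.mem_ker]
    change x ∈ kleinCobdry n M ↔ Q.kleinClass _ _ e x = 0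
    constructor
    · have hle : kleinCobdry n M
          ≤ (Q.kleinClass (DihedralGroup.r k) (DihedralGroup.sr 0) e).ker := by
        rw [kleinCobdry, AddSubgroup.closure_le]
        rintro _ ⟨s, m, hs, rfl⟩
        rw [SetLike.mem_coe, AddMonoidHom.mem_ker]
        induction hs using Subgroup.closure_induction generalizing m with
        | mem s hs =>
          rcases hs with rfl | rfl
          · exact Q.kleinClass_left K m
          · exact Q.kleinClass_right K m
        | one => rw [map_one, one_smul, sub_self, map_zero]
        | mul s s' _ _ hs hs' =>
          have h := congrArg₂ (· + ·) (hs (MonoidAlgebra.of ℤ (DihedralGroup n) s' • m)) (hs' m)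
          simp only [← map_add, sub_add_sub_cancel, add_zero] at h
          rw [map_mul, mul_smul, h]
        | inv s _ hs =>
          rw [← neg_eq_zero, ← hs (MonoidAlgebra.of ℤ (DihedralGroup n) s⁻¹ • m), ← map_neg, smul_smul,
            ← map_mul, mul_inv_cancel, map_one, one_smul, neg_sub]
      exact fun h => hle h
    · intro h
      rw [AddMonoidHom.mem_ker, hnorm] at hx
      obtain ⟨y, z, rfl⟩ := Q.exists_of_kleinClass_eq_zero K hx h
      exact add_mem
        (AddSubgroup.subset_closure ⟨_, y, Subgroup.subset_closure (by simp [hk]), rfl⟩)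
        (AddSubgroup.subset_closure ⟨_, z, Subgroup.subset_closure (by simp), rfl⟩)
  exact ⟨(QuotientAddGroup.quotientAddEquivOfEq hker).trans
    (QuotientAddGroup.quotientKerEquivOfSurjective Θ hsurj)⟩
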